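/- For every integer l ≥ 1, there exists a finite tree (a connected acyclic simple graph) on (l+1)² + 1 vertices that is not (1,l)-colorable. -/

import Mathlib

/-- A set of vertices of a simple graph is independent if no two of its elements
are adjacent. -/
def IndepOn {V : Type*} (G : SimpleGraph V) (s : Set V) : Prop :=
  ∀ ⦃u : V⦄, u ∈ s → ∀ ⦃v : V⦄, v ∈ s → ¬ G.Adj u v

/-- A set of vertices is 2-independent if any two distinct elements are at distance
greater than 2: they are non-adjacent and have no common neighbor. -/
def TwoIndepOn {V : Type*} (G : SimpleGraph V) (s : Set V) : Prop :=
  ∀ ⦃u : V⦄, u ∈ s → ∀ ⦃v : V⦄, v ∈ s → u ≠ v →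
    ¬ G.Adj u v ∧ ∀ w : V, ¬ (G.Adj u w ∧ G.Adj w v)

/-- `G` is `(a,b)`-colorable: its vertex set can be partitioned into `a` independent
sets and `b` 2-independent sets (classes are allowed to be empty). -/
def ABColorable {V : Type*} (G : SimpleGraph V) (a b : ℕ) : Prop :=
  ∃ f : V → Fin a ⊕ Fin b,
    (∀ i : Fin a, IndepOn G {v | f v = Sum.inl i}) ∧
    (∀ j : Fin b, TwoIndepOn G {v | f v = Sum.inr j})

/-- Among more than `b` distinct neighbors of a vertex, some neighbor gets an independent color. -/
theorem exists_neighbor_inl {V ι : Type*} [Fintype ι] {G : SimpleGraph V} {a b : ℕ}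
    {f : V → Fin a ⊕ Fin b} (hf : ∀ j : Fin b, TwoIndepOn G {v | f v = Sum.inr j})
    (u : V) (s : ι → V) (hs : Function.Injective s) (hadj : ∀ i, G.Adj u (s i))
    (hb : b < Fintype.card ι) : ∃ i c, f (s i) = Sum.inl c := by
  by_contra! h
  have hr : ∀ i, ∃ j, f (s i) = Sum.inr j := fun i ↦ by
    rcases hfi : f (s i) with c | j
    · exact absurd hfi (h i c)
    · exact ⟨j, rfl⟩
  choose g hg using hr
  obtain ⟨i, k, hik, hgik⟩ := Fintype.exists_ne_map_eq_of_card_lt g (by simpa using hb)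
  exact (hf (g i) (hg i) (by simp [hgik, hg]) (hs.ne hik)).2 u ⟨(hadj i).symm, hadj k⟩

theorem ABColorable.of_iso {V W : Type*} {G : SimpleGraph V} {H : SimpleGraph W} (e : G ≃g H)
    {a b : ℕ} (h : ABColorable H a b) : ABColorable G a b := by
  obtain ⟨f, h₁, h₂⟩ := h
  refine ⟨f ∘ e, fun i u hu v hv huv ↦ h₁ i hu hv (e.map_adj_iff.2 huv),
    fun j u hu v hv huv ↦ ?_⟩
  have := h₂ j hu hv (e.injective.ne huv)
  exact ⟨fun h ↦ this.1 (e.map_adj_iff.2 h),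
    fun w hw ↦ this.2 (e w) ⟨e.map_adj_iff.2 hw.1, e.map_adj_iff.2 hw.2⟩⟩

/-- The parent of a non-root vertex in the rooted tree of depth two: `none` is the root,
`some (i, none)` are its children, and `some (i, some j)` are the children of `some (i, none)`. -/
def depthTwoParent {α β : Type*} : α × Option β → Option (α × Option β)
  | (_, none) => none
  | (i, some _) => some (i, none)

/-- The rooted tree of depth two whose root has children indexed by `α`, each of which has
children indexed by `β`. -/
def depthTwoTree (α β : Type*) : SimpleGraph (Option (α × Option β)) where
  Adj u v := (∃ w, u = some w ∧ v = depthTwoParent w) ∨ (∃ w, v = some w ∧ u = depthTwoParent w)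
  symm := ⟨fun _ _ h ↦ h.symm⟩
  loopless := ⟨by
    rintro u (⟨⟨i, _ | j⟩, rfl, h⟩ | ⟨⟨i, _ | j⟩, rfl, h⟩) <;> simp [depthTwoParent] at h⟩

theorem depthTwoTree_adj_parent {α β : Type*} (w : α × Option β) :
    (depthTwoTree α β).Adj (depthTwoParent w) (some w) :=
  Or.inr ⟨w, rfl, rfl⟩

theorem depthTwoTree_connected (α β : Type*) : (depthTwoTree α β).Connected := by
  have hchild (i : α) : (depthTwoTree α β).Reachable none (some (i, none)) :=
    (depthTwoTree_adj_parent (i, none)).reachable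
  have hroot : ∀ v, (depthTwoTree α β).Reachable none v
    | none => .refl _
    | some (i, none) => hchild i
    | some (i, some j) => (hchild i).trans (depthTwoTree_adj_parent (i, some j)).reachable
  exact ⟨fun u v ↦ (hroot u).symm.trans (hroot v)⟩

theorem depthTwoTree_isTree (α β : Type*) [Finite α] [Finite β] :
    (depthTwoTree α β).IsTree := by
  have hc := depthTwoTree_connected α β
  refine SimpleGraph.isTree_iff_connected_and_card.2 ⟨hc, ?_⟩
  refine le_antisymm ?_ hc.card_vert_le_card_edgeSet_add_one
  rw [Finite.card_option]
  gcongr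
  have hsub : (depthTwoTree α β).edgeSet ⊆
      Set.range fun w : α × Option β ↦ s(some w, depthTwoParent w) := by
    intro e
    induction e with
    | _ u v =>
      rintro (⟨w, rfl, rfl⟩ | ⟨w, rfl, rfl⟩)
      · exact ⟨w, rfl⟩
      · exact ⟨w, Sym2.eq_swap⟩
  exact (Nat.card_mono (Set.finite_range _) hsub).trans (Finite.card_range_le _)

theorem depthTwoTree_not_colorable (l : ℕ) :
    ¬ ABColorable (depthTwoTree (Fin (l + 1)) (Fin l)) 1 l := by
  rintro ⟨f, h₁, h₂⟩
  obtain ⟨i, c, hi⟩ := exists_neighbor_inl h₂ none (fun i ↦ some (i, none))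
    (fun i k h ↦ by simpa using h) (fun i ↦ depthTwoTree_adj_parent (i, none)) (by simp)
  let s : Option (Fin l) → Option (Fin (l + 1) × Option (Fin l)) :=
    Option.map fun j ↦ (i, some j)
  have hs : ∀ j, (depthTwoTree (Fin (l + 1)) (Fin l)).Adj (some (i, none)) (s j)
    | none => (depthTwoTree_adj_parent (i, none)).symm
    | some j => depthTwoTree_adj_parent (i, some j)
  obtain ⟨j, d, hj⟩ := exists_neighbor_inl h₂ _ s
    (Option.map_injective fun j k h ↦ by simpa using h) hs (by simp)
  exact h₁ c hi (hj.trans (congrArg _ (Subsingleton.elim d c))) (hs j)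

theorem stmt_4 (l : ℕ) (hl : 1 ≤ l) :
    ∃ G : SimpleGraph (Fin ((l + 1) ^ 2 + 1)), G.IsTree ∧ ¬ ABColorable G 1 l := by
  let e : Option (Fin (l + 1) × Option (Fin l)) ≃ Fin ((l + 1) ^ 2 + 1) :=
    Fintype.equivFinOfCardEq (by simp [sq])
  let φ := SimpleGraph.Iso.map e (depthTwoTree (Fin (l + 1)) (Fin l))
  exact ⟨_, φ.isTree_iff.1 (depthTwoTree_isTree _ _),
    fun h ↦ depthTwoTree_not_colorable l (h.of_iso φ)⟩
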